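/- arXiv:1009.1359 — 2 statements merged into one kernel-verified Lean document; each statement's English description precedes it below -/
import Mathlib

section
/- Let ω be a fixed modulus of continuity, and for each dimension d ≥ 1 let M_d be the uncentered maximal operator on ℝ^d associated to balls of the ℓ∞ norm, with operator norm ‖M_d‖_{Op(ω)} computed with distances in the ℓ∞ norm. Then the sequence d ↦ ‖M_d‖_{Op(ω)} is nondecreasing in d, and lim_{d→∞} ‖M_d‖_{Op(ω)} = 1. -/
open MeasureTheory Set Filter Topology

/-- The closed ball of the norm-like function `N`, with center `c` and radius `R`. -/
def nball {d : ℕ} (N : (Fin d → ℝ) → ℝ) (c : Fin d → ℝ) (R : ℝ) : Set (Fin d → ℝ) :=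
  {y | N (y - c) ≤ R}

/-- The uncentered Hardy–Littlewood maximal function associated to the norm `N`,
with respect to `d`-dimensional Lebesgue measure. -/
noncomputable def maxFn {d : ℕ} (N : (Fin d → ℝ) → ℝ) (f : (Fin d → ℝ) → ℝ)
    (x : Fin d → ℝ) : ℝ :=
  sSup {a : ℝ | ∃ c : Fin d → ℝ, ∃ R : ℝ, 0 < R ∧ x ∈ nball N c R ∧
    a = ⨍ y in nball N c R, |f y|}

/-- The modulus of continuity of `g`, with distances measured using `N`. -/
noncomputable def modCont {d : ℕ} (N : (Fin d → ℝ) → ℝ) (g : (Fin d → ℝ) → ℝ) (δ : ℝ) : ℝ :=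
  sSup {a : ℝ | ∃ x y : Fin d → ℝ, N (x - y) ≤ δ ∧ a = |g x - g y|}

/-- `N` is a norm on `ℝ^d`. -/
structure IsNorm {d : ℕ} (N : (Fin d → ℝ) → ℝ) : Prop where
  eq_zero_iff : ∀ x, N x = 0 ↔ x = 0
  add_le : ∀ x y, N (x + y) ≤ N x + N y
  smul : ∀ (a : ℝ) (x), N (a • x) = |a| * N x

/-- `ω` is a modulus of continuity: continuous, nondecreasing, subadditive on `[0,∞)`,
vanishing at `0`, nonnegative, and not identically zero. -/
structure IsModulus (ω : ℝ → ℝ) : Prop where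
  nonneg : ∀ t, 0 ≤ t → 0 ≤ ω t
  map_zero : ω 0 = 0
  mono : MonotoneOn ω (Ici 0)
  subadd : ∀ a b, 0 ≤ a → 0 ≤ b → ω (a + b) ≤ ω a + ω b
  cont : ContinuousOn ω (Ici 0)
  nontrivial : ∃ t, 0 < t ∧ ω t ≠ 0

/-- The `Lip(ω)` seminorm of `f`: `sup_{t>0} ω(f,t)/ω(t)`. -/
noncomputable def lipNorm {d : ℕ} (N : (Fin d → ℝ) → ℝ) (ω : ℝ → ℝ)
    (f : (Fin d → ℝ) → ℝ) : ℝ :=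
  sSup {a : ℝ | ∃ t : ℝ, 0 < t ∧ a = modCont N f t / ω t}

/-- The operator norm of the uncentered maximal operator on `Lip(ω)`. -/
noncomputable def opNorm (d : ℕ) (N : (Fin d → ℝ) → ℝ) (ω : ℝ → ℝ) : ℝ :=
  sSup {a : ℝ | ∃ f : (Fin d → ℝ) → ℝ, lipNorm N ω f = 1 ∧ a = lipNorm N ω (maxFn N f)}

/-- The Hölder `α` seminorm of `f`, distances measured with `N`. -/
noncomputable def holderNorm {d : ℕ} (N : (Fin d → ℝ) → ℝ) (α : ℝ)
    (f : (Fin d → ℝ) → ℝ) : ℝ :=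
  sSup {a : ℝ | ∃ x y : Fin d → ℝ, x ≠ y ∧ a = |f x - f y| / N (x - y) ^ α}

/-- The operator norm of the uncentered maximal operator on the Hölder class `Lip_α`. -/
noncomputable def opNormHolder (d : ℕ) (N : (Fin d → ℝ) → ℝ) (α : ℝ) : ℝ :=
  sSup {a : ℝ | ∃ f : (Fin d → ℝ) → ℝ, holderNorm N α f = 1 ∧
    a = holderNorm N α (maxFn N f)}

lemma nball_norm {d : ℕ} (c : Fin d → ℝ) (R : ℝ) :
    nball (fun x => ‖x‖) c R = Metric.closedBall c R := by
  ext y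
  simp [nball, dist_eq_norm]

lemma IsModulus.pos {ω : ℝ → ℝ} (hω : IsModulus ω) {t : ℝ} (ht : 0 < t) : 0 < ω t := by
  refine lt_of_le_of_ne (hω.nonneg t ht.le) fun h0 => ?_
  obtain ⟨s, hs, hs0⟩ := hω.nontrivial
  have hmul : ∀ n : ℕ, ω (n * t) ≤ 0 := by
    intro n
    induction n with
    | zero => simp [hω.map_zero]
    | succ n ih =>
      have := hω.subadd (n * t) t (by positivity) ht.le
      push_cast
      rw [add_mul, one_mul]
      linarith
  obtain ⟨n, hn⟩ := exists_nat_ge (s / t)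
  rw [div_le_iff₀ ht] at hn
  have h1 := hω.mono (show s ∈ Ici 0 from hs.le) (show (n : ℝ) * t ∈ Ici 0 from hs.le.trans hn) hn
  exact hs0 (le_antisymm (h1.trans (hmul n)) (hω.nonneg s hs.le))

lemma IsModulus.exists_lt {ω : ℝ → ℝ} (hω : IsModulus ω) {ε : ℝ} (hε : 0 < ε) :
    ∃ η, 0 < η ∧ η < 1 ∧ ω η < ε := by
  have h0 : Tendsto ω (𝓝[>] 0) (𝓝 0) := by
    have := (hω.cont 0 self_mem_Ici).tendsto
    rw [hω.map_zero] at this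
    exact this.mono_left (nhdsWithin_mono 0 Ioi_subset_Ici_self)
  obtain ⟨η, h1, h2⟩ := ((h0.eventually_lt_const hε).and (Ioo_mem_nhdsGT one_pos)).exists
  exact ⟨η, h2.1, h2.2, h1⟩

/-- An oscillation bound at scale `s` propagates to the scales `n * s`. -/
lemma abs_sub_le_nat_mul {E : Type*} [NormedAddCommGroup E] [NormedSpace ℝ E] {f : E → ℝ}
    {s C : ℝ} (h : ∀ x y, ‖x - y‖ ≤ s → |f x - f y| ≤ C) (n : ℕ) :
    ∀ x y, ‖x - y‖ ≤ n * s → |f x - f y| ≤ n * C := by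
  induction n with
  | zero =>
    intro x y hxy
    have : x = y := by simpa [sub_eq_zero] using hxy
    simp [this]
  | succ n ih =>
    intro x y hxy
    have hn : (0 : ℝ) < n + 1 := by positivity
    push_cast at hxy ⊢
    set z := x - ((n : ℝ) + 1)⁻¹ • (x - y) with hz
    have hxz : x - z = ((n : ℝ) + 1)⁻¹ • (x - y) := by rw [hz]; abel
    have hzy : z - y = ((n : ℝ) * ((n : ℝ) + 1)⁻¹) • (x - y) := by
      have : (n : ℝ) * ((n : ℝ) + 1)⁻¹ = 1 - ((n : ℝ) + 1)⁻¹ := by field_simp; ring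
      rw [this, sub_smul, one_smul, hz]; abel
    have hle : ((n : ℝ) + 1)⁻¹ * ‖x - y‖ ≤ s := by
      rw [inv_mul_le_iff₀ hn]; exact hxy
    have h1 := h x z (by
      rw [hxz, norm_smul, Real.norm_of_nonneg (by positivity)]; exact hle)
    have h2 := ih z y (by
      rw [hzy, norm_smul, Real.norm_of_nonneg (by positivity), mul_assoc]
      exact mul_le_mul_of_nonneg_left hle (by positivity))
    linarith [abs_sub_le (f x) (f z) (f y)]

lemma abs_sub_le_of_lipNorm_eq_one {d : ℕ} {ω : ℝ → ℝ} (hω : IsModulus ω)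
    {f : (Fin d → ℝ) → ℝ} (hf : lipNorm (fun x => ‖x‖) ω f = 1) (x y : Fin d → ℝ) :
    |f x - f y| ≤ ω ‖x - y‖ := by
  have hbdd : BddAbove {a : ℝ | ∃ t : ℝ, 0 < t ∧ a = modCont (fun x => ‖x‖) f t / ω t} := by
    by_contra h
    simp [lipNorm, Real.sSup_of_not_bddAbove h] at hf
  rcases eq_or_ne x y with rfl | hxy
  · simp [hω.map_zero]
  have ht : 0 < ‖x - y‖ := norm_pos_iff.2 (sub_ne_zero.2 hxy)
  have hle : modCont (fun x => ‖x‖) f ‖x - y‖ ≤ ω ‖x - y‖ := by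
    have := le_csSup hbdd ⟨‖x - y‖, ht, rfl⟩
    change _ ≤ lipNorm (fun x => ‖x‖) ω f at this
    rwa [hf, div_le_one (hω.pos ht)] at this
  by_cases hb : BddAbove {a : ℝ | ∃ u v : Fin d → ℝ, ‖u - v‖ ≤ ‖x - y‖ ∧ a = |f u - f v|}
  · exact (le_csSup hb ⟨x, y, le_rfl, rfl⟩).trans hle
  have hzero : ∀ s, 0 < s → modCont (fun x => ‖x‖) f s = 0 := by
    intro s hs
    refine Real.sSup_of_not_bddAbove fun ⟨C, hC⟩ => hb ?_
    obtain ⟨n, hn⟩ := exists_nat_ge (‖x - y‖ / s)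
    rw [div_le_iff₀ hs] at hn
    refine ⟨n * C, ?_⟩
    rintro _ ⟨u, v, huv, rfl⟩
    exact abs_sub_le_nat_mul (fun u v h => hC ⟨u, v, h, rfl⟩) n u v (huv.trans hn)
  have : lipNorm (fun x => ‖x‖) ω f ≤ 0 := by
    refine Real.sSup_nonpos ?_
    rintro _ ⟨t, ht, rfl⟩
    simp [hzero t ht]
  linarith

lemma modCont_le {d : ℕ} {ω : ℝ → ℝ} (hω : IsModulus ω) {g : (Fin d → ℝ) → ℝ}
    (hg : ∀ x y, |g x - g y| ≤ ω ‖x - y‖) {t : ℝ} (ht : 0 ≤ t) :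
    modCont (fun x => ‖x‖) g t ≤ ω t := by
  refine Real.sSup_le ?_ (hω.nonneg t ht)
  rintro _ ⟨x, y, hxy, rfl⟩
  exact (hg x y).trans (hω.mono (norm_nonneg _) ht hxy)

lemma lipNorm_le_one {d : ℕ} {ω : ℝ → ℝ} (hω : IsModulus ω) {g : (Fin d → ℝ) → ℝ}
    (hg : ∀ x y, |g x - g y| ≤ ω ‖x - y‖) : lipNorm (fun x => ‖x‖) ω g ≤ 1 := by
  refine Real.sSup_le ?_ zero_le_one
  rintro _ ⟨t, ht, rfl⟩
  exact div_le_one_of_le₀ (modCont_le hω hg ht.le) (hω.nonneg t ht.le)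

lemma div_le_lipNorm {d : ℕ} {ω : ℝ → ℝ} (hω : IsModulus ω) {g : (Fin d → ℝ) → ℝ}
    (hg : ∀ x y, |g x - g y| ≤ ω ‖x - y‖) {t : ℝ} (ht : 0 < t) {x y : Fin d → ℝ}
    (hxy : ‖x - y‖ ≤ t) : |g x - g y| / ω t ≤ lipNorm (fun x => ‖x‖) ω g := by
  have h1 : |g x - g y| ≤ modCont (fun x => ‖x‖) g t := by
    refine le_csSup ⟨ω t, ?_⟩ ⟨x, y, hxy, rfl⟩
    rintro _ ⟨u, v, huv, rfl⟩
    exact (hg u v).trans (hω.mono (norm_nonneg _) ht.le huv)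
  refine (div_le_div_of_nonneg_right h1 (hω.nonneg t ht.le)).trans ?_
  refine le_csSup ⟨1, ?_⟩ ⟨t, ht, rfl⟩
  rintro _ ⟨s, hs, rfl⟩
  exact div_le_one_of_le₀ (modCont_le hω hg hs.le) (hω.nonneg s hs.le)

lemma continuous_of_abs_sub_le {E : Type*} [SeminormedAddCommGroup E] {ω : ℝ → ℝ}
    (hω : IsModulus ω) {f : E → ℝ} (hf : ∀ x y, |f x - f y| ≤ ω ‖x - y‖) : Continuous f := by
  rw [Metric.continuous_iff]
  intro x ε hε
  obtain ⟨η, h0, -, h⟩ := hω.exists_lt hε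
  refine ⟨η, h0, fun y hy => ?_⟩
  rw [dist_eq_norm] at hy
  rw [Real.dist_eq]
  exact ((hf y x).trans (hω.mono (norm_nonneg _) h0.le hy.le)).trans_lt h

section Average

variable {d : ℕ} {f g : (Fin d → ℝ) → ℝ} {c : Fin d → ℝ} {R : ℝ}

lemma volume_real_closedBall_pos (hR : 0 < R) : 0 < volume.real (Metric.closedBall c R) :=
  ENNReal.toReal_pos (Metric.measure_closedBall_pos _ _ hR).ne' measure_closedBall_lt_top.ne

lemma setAverage_closedBall_mono (hf : Continuous f) (hg : Continuous g)
    (h : ∀ y ∈ Metric.closedBall c R, f y ≤ g y) :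
    ⨍ y in Metric.closedBall c R, f y ≤ ⨍ y in Metric.closedBall c R, g y := by
  rw [setAverage_eq, setAverage_eq]
  have hK := isCompact_closedBall c R
  exact smul_le_smul_of_nonneg_left (setIntegral_mono_on
    (hf.continuousOn.integrableOn_compact hK) (hg.continuousOn.integrableOn_compact hK)
    measurableSet_closedBall h) (by positivity)

lemma setAverage_closedBall_const (hR : 0 < R) (a : ℝ) :
    ⨍ _ in Metric.closedBall c R, a = a :=
  setAverage_const (Metric.measure_closedBall_pos _ _ hR).ne' measure_closedBall_lt_top.ne a

lemma setAverage_closedBall_add_const (hR : 0 < R) (hf : Continuous f) (a : ℝ) :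
    ⨍ y in Metric.closedBall c R, (f y + a) = (⨍ y in Metric.closedBall c R, f y) + a := by
  conv_rhs => rw [← setAverage_closedBall_const (c := c) hR a]
  simp only [setAverage_eq]
  rw [integral_add (hf.continuousOn.integrableOn_compact (isCompact_closedBall c R))
    (continuousOn_const.integrableOn_compact (isCompact_closedBall c R)), smul_add]

lemma setAverage_closedBall_translate (v : Fin d → ℝ) :
    ⨍ y in Metric.closedBall (c + v) R, f y = ⨍ y in Metric.closedBall c R, f (y + v) := by
  have hpre : (· + v) ⁻¹' Metric.closedBall (c + v) R = Metric.closedBall c R := by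
    ext y
    simp [dist_eq_norm]
  have hmp := measurePreserving_add_right (volume : Measure (Fin d → ℝ)) v
  rw [setAverage_eq, setAverage_eq, ← hpre, hmp.setIntegral_preimage_emb
    (measurableEmbedding_addRight v), measureReal_def, measureReal_def,
    hmp.measure_preimage measurableSet_closedBall.nullMeasurableSet]

end Average

/-- Translating cubes shows that the maximal function has the same modulus of continuity. -/
lemma abs_maxFn_sub_le {d : ℕ} {ω : ℝ → ℝ} (hω : IsModulus ω) {f : (Fin d → ℝ) → ℝ}
    (hf : ∀ x y, |f x - f y| ≤ ω ‖x - y‖) (x y : Fin d → ℝ) :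
    |maxFn (fun x => ‖x‖) f x - maxFn (fun x => ‖x‖) f y| ≤ ω ‖x - y‖ := by
  have hc := continuous_of_abs_sub_le hω hf
  set S : (Fin d → ℝ) → Set ℝ := fun x => {a : ℝ | ∃ c : Fin d → ℝ, ∃ R : ℝ, 0 < R ∧
    x ∈ nball (fun x => ‖x‖) c R ∧ a = ⨍ y in nball (fun x => ‖x‖) c R, |f y|}
  have hne : ∀ x, (S x).Nonempty := fun x =>
    ⟨_, x, 1, one_pos, by simp [nball_norm], rfl⟩
  have key : ∀ x y, ∀ a ∈ S x, ∃ b ∈ S y, a ≤ b + ω ‖x - y‖ := by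
    rintro x y _ ⟨c, R, hR, hx, rfl⟩
    refine ⟨_, ⟨c + (y - x), R, hR, ?_, rfl⟩, ?_⟩
    · rw [nball_norm, mem_closedBall_iff_norm] at hx ⊢
      convert hx using 2
      abel
    · rw [nball_norm, nball_norm, setAverage_closedBall_translate,
        ← setAverage_closedBall_add_const hR (by fun_prop)]
      refine setAverage_closedBall_mono (by fun_prop) (by fun_prop) fun z _ => ?_
      have h1 := hf z (z + (y - x))
      rw [show z - (z + (y - x)) = x - y by abel] at h1
      linarith [abs_sub_abs_le_abs_sub (f z) (f (z + (y - x)))]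
  have hbdd : ∀ x y, BddAbove (S y) → BddAbove (S x) := by
    rintro x y ⟨C, hC⟩
    refine ⟨C + ω ‖x - y‖, fun a ha => ?_⟩
    obtain ⟨b, hb, hab⟩ := key x y a ha
    linarith [hC hb]
  have hle : ∀ x y, sSup (S x) ≤ sSup (S y) + ω ‖x - y‖ := by
    intro x y
    by_cases hb : BddAbove (S y)
    · refine csSup_le (hne x) fun a ha => ?_
      obtain ⟨b, hb', hab⟩ := key x y a ha
      linarith [le_csSup hb hb']
    · rw [Real.sSup_of_not_bddAbove hb, Real.sSup_of_not_bddAbove fun h => hb (hbdd y x h)]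
      linarith [hω.nonneg _ (norm_nonneg (x - y))]
  have h1 := hle x y
  have h2 := hle y x
  rw [norm_sub_rev] at h2
  change |sSup (S x) - sSup (S y)| ≤ _
  rw [abs_le]
  constructor <;> linarith

lemma mem_upperBounds_opNorm {d : ℕ} {ω : ℝ → ℝ} (hω : IsModulus ω) :
    (1 : ℝ) ∈ upperBounds {a : ℝ | ∃ f : (Fin d → ℝ) → ℝ, lipNorm (fun x => ‖x‖) ω f = 1 ∧
      a = lipNorm (fun x => ‖x‖) ω (maxFn (fun x => ‖x‖) f)} := by
  rintro _ ⟨f, hf, rfl⟩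
  exact lipNorm_le_one hω (abs_maxFn_sub_le hω (abs_sub_le_of_lipNorm_eq_one hω hf))

lemma opNorm_le_one {d : ℕ} {ω : ℝ → ℝ} (hω : IsModulus ω) :
    opNorm d (fun x => ‖x‖) ω ≤ 1 :=
  Real.sSup_le (mem_upperBounds_opNorm hω) zero_le_one

lemma modCont_comp_tail {d : ℕ} (f : (Fin d → ℝ) → ℝ) (t : ℝ) :
    modCont (fun x => ‖x‖) (fun x : Fin (d + 1) → ℝ => f (Fin.tail x)) t =
      modCont (fun x => ‖x‖) f t := by
  unfold modCont
  congr 1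
  ext a
  constructor
  · rintro ⟨x, y, hxy, rfl⟩
    refine ⟨Fin.tail x, Fin.tail y, ?_, rfl⟩
    have ht : 0 ≤ t := (norm_nonneg _).trans hxy
    rw [pi_norm_le_iff_of_nonneg ht] at hxy ⊢
    exact fun i => hxy i.succ
  · rintro ⟨x, y, hxy, rfl⟩
    refine ⟨Fin.cons 0 x, Fin.cons 0 y, ?_, by simp⟩
    have ht : 0 ≤ t := (norm_nonneg _).trans hxy
    rw [pi_norm_le_iff_of_nonneg ht] at hxy ⊢
    refine Fin.cases ?_ fun i => ?_
    · simpa using ht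
    · simpa using hxy i

lemma lipNorm_comp_tail {d : ℕ} (ω : ℝ → ℝ) (f : (Fin d → ℝ) → ℝ) :
    lipNorm (fun x => ‖x‖) ω (fun x : Fin (d + 1) → ℝ => f (Fin.tail x)) =
      lipNorm (fun x => ‖x‖) ω f := by
  simp only [lipNorm, modCont_comp_tail]

lemma mem_closedBall_iff_tail {d : ℕ} {c x : Fin (d + 1) → ℝ} {R : ℝ} (hR : 0 ≤ R) :
    x ∈ Metric.closedBall c R ↔
      x 0 ∈ Metric.closedBall (c 0) R ∧ Fin.tail x ∈ Metric.closedBall (Fin.tail c) R := by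
  simp only [Metric.mem_closedBall, dist_pi_le_iff hR, Fin.forall_fin_succ, Fin.tail]

lemma setAverage_comp_tail {d : ℕ} (f : (Fin d → ℝ) → ℝ) (c : Fin (d + 1) → ℝ) {R : ℝ}
    (hR : 0 < R) :
    ⨍ y in Metric.closedBall c R, f (Fin.tail y) =
      ⨍ y in Metric.closedBall (Fin.tail c) R, f y := by
  have hmp := volume_preserving_piFinSuccAbove (fun _ : Fin (d + 1) => ℝ) 0
  set e := MeasurableEquiv.piFinSuccAbove (fun _ : Fin (d + 1) => ℝ) 0
  have he : ∀ y, e y = (y 0, Fin.tail y) := fun y => by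
    ext <;> simp [e, MeasurableEquiv.piFinSuccAbove, Fin.tail]
  have hpre : e ⁻¹' (Metric.closedBall (c 0) R ×ˢ Metric.closedBall (Fin.tail c) R) =
      Metric.closedBall c R := by
    ext y
    rw [mem_preimage, he, mem_prod, mem_closedBall_iff_tail hR.le]
  have hint : ∫ y in Metric.closedBall c R, f (Fin.tail y) =
      volume.real (Metric.closedBall (c 0) R) * ∫ y in Metric.closedBall (Fin.tail c) R, f y := by
    have h1 := hmp.setIntegral_preimage_emb e.measurableEmbedding
      (fun p : ℝ × (Fin d → ℝ) => (1 : ℝ) * f p.2)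
      (Metric.closedBall (c 0) R ×ˢ Metric.closedBall (Fin.tail c) R)
    have h2 := setIntegral_prod_mul (μ := (volume : Measure ℝ))
      (ν := (volume : Measure (Fin d → ℝ))) (fun _ : ℝ => (1 : ℝ)) f
      (Metric.closedBall (c 0) R) (Metric.closedBall (Fin.tail c) R)
    rw [hpre] at h1
    simp only [he, one_mul] at h1 h2
    rw [h1, Measure.volume_eq_prod, h2]
    simp
  have hvol : volume.real (Metric.closedBall c R) =
      volume.real (Metric.closedBall (c 0) R) * volume.real (Metric.closedBall (Fin.tail c) R) := by
    rw [← hpre, measureReal_def, hmp.measure_preimage_equiv, Measure.volume_eq_prod,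
      Measure.prod_prod, ENNReal.toReal_mul]
    rfl
  have h0 : 0 < volume.real (Metric.closedBall (c 0) R) :=
    ENNReal.toReal_pos (Metric.measure_closedBall_pos _ _ hR).ne' measure_closedBall_lt_top.ne
  rw [setAverage_eq, setAverage_eq, hint, hvol, smul_eq_mul, smul_eq_mul, mul_inv]
  field_simp

lemma maxFn_comp_tail {d : ℕ} (f : (Fin d → ℝ) → ℝ) :
    maxFn (fun x => ‖x‖) (fun x : Fin (d + 1) → ℝ => f (Fin.tail x)) =
      fun x => maxFn (fun x => ‖x‖) f (Fin.tail x) := by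
  funext x
  unfold maxFn
  congr 1
  ext a
  simp only [nball_norm]
  constructor
  · rintro ⟨c, R, hR, hx, rfl⟩
    exact ⟨Fin.tail c, R, hR, ((mem_closedBall_iff_tail hR.le).1 hx).2,
      setAverage_comp_tail (fun y => |f y|) c hR⟩
  · rintro ⟨c, R, hR, hx, rfl⟩
    refine ⟨Fin.cons (x 0) c, R, hR, (mem_closedBall_iff_tail hR.le).2 ⟨?_, ?_⟩, ?_⟩
    · simpa using hR.le
    · simpa using hx
    · rw [setAverage_comp_tail (fun y => |f y|) _ hR, Fin.tail_cons]

lemma lipNorm_nonneg {d : ℕ} {ω : ℝ → ℝ} (hω : IsModulus ω) (f : (Fin d → ℝ) → ℝ) :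
    0 ≤ lipNorm (fun x => ‖x‖) ω f := by
  refine Real.sSup_nonneg ?_
  rintro _ ⟨t, ht, rfl⟩
  refine div_nonneg (Real.sSup_nonneg ?_) (hω.nonneg t ht.le)
  rintro _ ⟨x, y, -, rfl⟩
  exact abs_nonneg _

lemma opNorm_le_succ {ω : ℝ → ℝ} (hω : IsModulus ω) (d : ℕ) :
    opNorm d (fun x => ‖x‖) ω ≤ opNorm (d + 1) (fun x => ‖x‖) ω := by
  refine Real.sSup_le ?_ (Real.sSup_nonneg ?_)
  · rintro _ ⟨f, hf, rfl⟩
    refine le_csSup ⟨1, mem_upperBounds_opNorm hω⟩ ⟨fun x => f (Fin.tail x), ?_, ?_⟩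
    · rw [lipNorm_comp_tail, hf]
    · rw [maxFn_comp_tail, lipNorm_comp_tail]
  · rintro _ ⟨f, -, rfl⟩
    exact lipNorm_nonneg hω _

/-- A bump of height `ω 1` at the origin, supported in the unit cube. -/
noncomputable def modulusBump (ω : ℝ → ℝ) {d : ℕ} (y : Fin d → ℝ) : ℝ :=
  ω 1 - ω (min ‖y‖ 1)

section Bump

variable {d : ℕ} {ω : ℝ → ℝ}

lemma modulusBump_nonneg (hω : IsModulus ω) (y : Fin d → ℝ) : 0 ≤ modulusBump ω y :=
  sub_nonneg.2 (hω.mono (le_min (norm_nonneg y) zero_le_one) (mem_Ici.2 zero_le_one)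
    (min_le_right _ _))

lemma modulusBump_le (hω : IsModulus ω) (y : Fin d → ℝ) : modulusBump ω y ≤ ω 1 :=
  sub_le_self _ (hω.nonneg _ (le_min (norm_nonneg y) zero_le_one))

lemma modulusBump_zero (hω : IsModulus ω) : modulusBump ω (0 : Fin d → ℝ) = ω 1 := by
  simp [modulusBump, hω.map_zero]

lemma modulusBump_of_one_le {y : Fin d → ℝ} (hy : 1 ≤ ‖y‖) : modulusBump ω y = 0 := by
  simp [modulusBump, hy]

lemma abs_modulusBump_sub_le (hω : IsModulus ω) (x y : Fin d → ℝ) :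
    |modulusBump ω x - modulusBump ω y| ≤ ω ‖x - y‖ := by
  have key : ∀ x y : Fin d → ℝ, ω (min ‖x‖ 1) ≤ ω (min ‖y‖ 1) + ω ‖x - y‖ := by
    intro x y
    have hy : 0 ≤ min ‖y‖ 1 := le_min (norm_nonneg y) zero_le_one
    refine le_trans (hω.mono (le_min (norm_nonneg x) zero_le_one)
      (mem_Ici.2 (by positivity)) ?_) (hω.subadd _ _ hy (norm_nonneg _))
    have h1 : ‖x‖ ≤ ‖y‖ + ‖x - y‖ := norm_le_norm_add_norm_sub' x y
    rcases le_total ‖y‖ 1 with h | h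
    · rw [min_eq_left h]; exact (min_le_left _ _).trans h1
    · rw [min_eq_right h]; exact (min_le_right _ _).trans (by linarith [norm_nonneg (x - y)])
  have h1 := key x y
  have h2 := key y x
  rw [norm_sub_rev] at h2
  rw [modulusBump, modulusBump, abs_le]
  constructor <;> linarith

lemma continuous_modulusBump (hω : IsModulus ω) :
    Continuous (modulusBump ω : (Fin d → ℝ) → ℝ) :=
  continuous_of_abs_sub_le hω (abs_modulusBump_sub_le hω)

lemma norm_one_sub_zero (hd : 1 ≤ d) : ‖(0 : Fin d → ℝ) - 1‖ = 1 := by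
  have : Nonempty (Fin d) := ⟨⟨0, hd⟩⟩
  simp

lemma lipNorm_modulusBump (hω : IsModulus ω) (hd : 1 ≤ d) :
    lipNorm (fun x => ‖x‖) ω (modulusBump ω : (Fin d → ℝ) → ℝ) = 1 := by
  refine le_antisymm (lipNorm_le_one hω (abs_modulusBump_sub_le hω)) ?_
  have hn := norm_one_sub_zero hd
  have h := div_le_lipNorm hω (abs_modulusBump_sub_le hω) one_pos hn.le
  rw [modulusBump_zero hω, modulusBump_of_one_le (by simpa using hn.ge), sub_zero,
    abs_of_pos (hω.pos one_pos), div_self (hω.pos one_pos).ne'] at h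
  exact h

lemma le_maxFn_modulusBump_zero (hω : IsModulus ω) {η : ℝ} (hη : 0 < η) :
    ω 1 - ω η ≤ maxFn (fun x => ‖x‖) (modulusBump ω) (0 : Fin d → ℝ) := by
  have hc := continuous_modulusBump (d := d) hω
  have hmem : (⨍ y in Metric.closedBall (0 : Fin d → ℝ) η, |modulusBump ω y|) ≤
      maxFn (fun x => ‖x‖) (modulusBump ω) (0 : Fin d → ℝ) := by
    refine le_csSup ⟨ω 1, ?_⟩ ⟨0, η, hη, by simpa [nball_norm] using hη.le, by rw [nball_norm]⟩
    rintro _ ⟨c, R, hR, -, rfl⟩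
    rw [nball_norm, ← setAverage_closedBall_const (c := c) hR (ω 1)]
    refine setAverage_closedBall_mono (by fun_prop) continuous_const fun y _ => ?_
    rw [abs_of_nonneg (modulusBump_nonneg hω y)]
    exact modulusBump_le hω y
  refine le_trans ?_ hmem
  rw [← setAverage_closedBall_const (c := (0 : Fin d → ℝ)) hη (ω 1 - ω η)]
  refine setAverage_closedBall_mono continuous_const (by fun_prop) fun y hy => ?_
  refine le_trans ?_ (le_abs_self _)
  rw [mem_closedBall_zero_iff] at hy
  exact sub_le_sub_left (hω.mono (le_min (norm_nonneg y) zero_le_one) hη.le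
    ((min_le_left _ _).trans hy)) _

end Bump

/-- A cube containing the corner `(1, …, 1)` meets the cube `[-(1 - η), 1 - η]^d` in an
exponentially small proportion of its volume. -/
lemma volume_real_closedBall_inter_le {d : ℕ} {η : ℝ} (h0 : 0 < η) (h1 : η < 1)
    {c : Fin d → ℝ} {R : ℝ} (hR : 0 < R) (hc : (1 : Fin d → ℝ) ∈ Metric.closedBall c R) :
    volume.real (Metric.closedBall 0 (1 - η) ∩ Metric.closedBall c R) ≤
      (2 / (2 + η)) ^ d * volume.real (Metric.closedBall c R) := by
  have hq : 0 ≤ 2 / (2 + η) := by positivity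
  have hcoord : ∀ i, volume (Metric.closedBall (0 : ℝ) (1 - η) ∩ Metric.closedBall (c i) R) ≤
      ENNReal.ofReal (2 / (2 + η) * (2 * R)) := by
    intro i
    have hi : |1 - c i| ≤ R := by
      have := (dist_pi_le_iff hR.le).1 hc i
      simpa [Real.dist_eq] using this
    rw [abs_le] at hi
    rw [Real.closedBall_eq_Icc, Real.closedBall_eq_Icc, Icc_inter_Icc, Real.volume_Icc]
    refine ENNReal.ofReal_le_ofReal ?_
    set l := (0 + (1 - η)) ⊓ (c i + R) - (0 - (1 - η)) ⊔ (c i - R) with hl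
    have hl1 : l ≤ 2 * R - η := by
      have e1 : (0 + (1 - η)) ⊓ (c i + R) ≤ 0 + (1 - η) := inf_le_left
      have e2 : c i - R ≤ (0 - (1 - η)) ⊔ (c i - R) := le_sup_right
      linarith
    have hl2 : l ≤ 2 := by
      have e1 : (0 + (1 - η)) ⊓ (c i + R) ≤ 0 + (1 - η) := inf_le_left
      have e2 : 0 - (1 - η) ≤ (0 - (1 - η)) ⊔ (c i - R) := le_sup_left
      linarith
    rw [div_mul_eq_mul_div, le_div_iff₀ (by positivity)]
    nlinarith
  have hvol : volume.real (Metric.closedBall c R) = (2 * R) ^ d := by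
    rw [measureReal_def, Real.volume_pi_closedBall c hR.le,
      ENNReal.toReal_ofReal (by positivity), Fintype.card_fin]
  rw [hvol, ← mul_pow, measureReal_def]
  refine ENNReal.toReal_le_of_le_ofReal (by positivity) ?_
  rw [closedBall_pi _ (by linarith), closedBall_pi _ hR.le, ← pi_inter_distrib, volume_pi_pi]
  calc _ ≤ ∏ _i : Fin d, ENNReal.ofReal (2 / (2 + η) * (2 * R)) :=
        Finset.prod_le_prod' fun i _ => hcoord i
    _ = _ := by rw [Finset.prod_const, Finset.card_univ, Fintype.card_fin,
        ENNReal.ofReal_pow (by positivity)]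

lemma maxFn_modulusBump_one_le {d : ℕ} {ω : ℝ → ℝ} (hω : IsModulus ω) {η : ℝ} (h0 : 0 < η)
    (h1 : η < 1) :
    maxFn (fun x => ‖x‖) (modulusBump ω) (1 : Fin d → ℝ) ≤
      (2 / (2 + η)) ^ d * ω 1 + ω η := by
  have hω1 := hω.nonneg 1 zero_le_one
  have hωη := hω.nonneg η h0.le
  refine Real.sSup_le ?_ (by positivity)
  rintro _ ⟨c, R, hR, hx, rfl⟩
  rw [nball_norm] at hx ⊢
  set B := Metric.closedBall c R
  set C : Set (Fin d → ℝ) := Metric.closedBall 0 (1 - η) with hC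
  have hV : 0 < volume.real B := volume_real_closedBall_pos hR
  have hBtop : volume B ≠ ⊤ := measure_closedBall_lt_top.ne
  have hCm : MeasurableSet C := measurableSet_closedBall
  have hI1 : IntegrableOn (C.indicator fun _ => ω 1) B :=
    (integrableOn_const hBtop).indicator hCm
  have hI2 : IntegrableOn (fun _ => ω η) B := integrableOn_const hBtop
  have hc := continuous_modulusBump (d := d) hω
  have hint : ∫ y in B, |modulusBump ω y| ≤ ∫ y in B, (C.indicator (fun _ => ω 1) y + ω η) := by
    refine setIntegral_mono_on (hc.abs.continuousOn.integrableOn_compact (isCompact_closedBall c R))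
      (hI1.add hI2) measurableSet_closedBall fun y _ => ?_
    rw [abs_of_nonneg (modulusBump_nonneg hω y)]
    by_cases hy : y ∈ C
    · rw [indicator_of_mem hy]
      linarith [modulusBump_le hω y]
    · rw [indicator_of_notMem hy, zero_add, modulusBump]
      rw [hC, mem_closedBall_zero_iff, not_le] at hy
      have e1 := hω.subadd (1 - η) η (by linarith) h0.le
      have e2 : ω (1 - η) ≤ ω (min ‖y‖ 1) := hω.mono (show (0 : ℝ) ≤ 1 - η by linarith)
        (le_min (norm_nonneg y) zero_le_one) (le_min hy.le (by linarith))
      rw [sub_add_cancel] at e1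
      linarith
  have heq : ∫ y in B, (C.indicator (fun _ => ω 1) y + ω η) =
      volume.real (C ∩ B) * ω 1 + volume.real B * ω η := by
    rw [integral_add hI1 hI2, integral_indicator hCm, Measure.restrict_restrict hCm,
      setIntegral_const, setIntegral_const, smul_eq_mul, smul_eq_mul]
  have hCB := volume_real_closedBall_inter_le h0 h1 hR hx
  rw [setAverage_eq, smul_eq_mul, inv_mul_le_iff₀ hV]
  calc _ ≤ volume.real (C ∩ B) * ω 1 + volume.real B * ω η := hint.trans_eq heq
    _ ≤ (2 / (2 + η)) ^ d * volume.real B * ω 1 + volume.real B * ω η := by gcongr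
    _ = _ := by ring

lemma le_opNorm {d : ℕ} (hd : 1 ≤ d) {ω : ℝ → ℝ} (hω : IsModulus ω) {η : ℝ} (h0 : 0 < η)
    (h1 : η < 1) :
    1 - (2 / (2 + η)) ^ d - 2 * ω η / ω 1 ≤ opNorm d (fun x => ‖x‖) ω := by
  have hω1 := hω.pos one_pos
  have hM := abs_maxFn_sub_le hω (abs_modulusBump_sub_le (d := d) hω)
  have hle := div_le_lipNorm hω hM one_pos (norm_one_sub_zero hd).le
  refine le_trans ?_ (hle.trans
    (le_csSup ⟨1, mem_upperBounds_opNorm hω⟩ ⟨_, lipNorm_modulusBump hω hd, rfl⟩))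
  rw [le_div_iff₀ hω1, sub_mul, div_mul_cancel₀ _ hω1.ne']
  refine le_trans ?_ (le_abs_self _)
  linarith [le_maxFn_modulusBump_zero (d := d) hω h0, maxFn_modulusBump_one_le (d := d) hω h0 h1]

/-- For a fixed modulus of continuity `ω`, the operator norm of the uncentered maximal
operator associated to `ℓ∞` balls (with `ℓ∞` distances) is nondecreasing in the dimension
`d`, and tends to `1` as `d → ∞`. -/
theorem stmt6 (ω : ℝ → ℝ) (hω : IsModulus ω) :
    (∀ d : ℕ, 1 ≤ d →
      opNorm d (fun x => ‖x‖) ω ≤ opNorm (d + 1) (fun x => ‖x‖) ω) ∧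
    Filter.Tendsto (fun d : ℕ => opNorm d (fun x => ‖x‖) ω) Filter.atTop (nhds 1) := by
  refine ⟨fun d _ => opNorm_le_succ hω d, tendsto_order.2 ⟨fun a ha => ?_, fun a ha =>
    Eventually.of_forall fun d => (opNorm_le_one hω).trans_lt ha⟩⟩
  have hω1 := hω.pos one_pos
  obtain ⟨η, h0, h1, hη⟩ := hω.exists_lt (ε := (1 - a) / 4 * ω 1)
    (mul_pos (by linarith) hω1)
  have hsmall : 2 * ω η / ω 1 < (1 - a) / 2 := by
    rw [div_lt_iff₀ hω1]
    linarith
  have hq : Tendsto (fun d : ℕ => (2 / (2 + η)) ^ d) atTop (𝓝 0) :=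
    tendsto_pow_atTop_nhds_zero_of_lt_one (by positivity)
      ((div_lt_one (by positivity)).2 (by linarith))
  filter_upwards [hq.eventually_lt_const (show 0 < (1 - a) / 2 by linarith),
    eventually_ge_atTop 1] with d hd hd1
  linarith [le_opNorm hd1 hω h0 h1]
end

section
/- Let d ≥ 1, let α ∈ (0,1], and let M be the uncentered maximal operator on (ℝ^d, ‖·‖_∞) associated to ℓ∞ balls, acting on the Hölder class Lip_α(ℝ^d, ‖·‖_∞). Then ‖M‖_{Op(α)} = min_{0 ≤ s ≤ 1} { (d/(1+s)^d) [ 2^d s^{α+d}/(α+d) + Σ_{j=0}^{d−1} C(d−1, j) (s^{d−1−j} − s^{d+α})/(α+j+1) ] }, where C(d−1, j) denotes the binomial coefficient. -/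
open MeasureTheory Set Filter Topology

lemma setAverage_closedBall_eq_unitBall {E F : Type*} [NormedAddCommGroup E] [NormedSpace ℝ E]
    [FiniteDimensional ℝ E] [MeasurableSpace E] [BorelSpace E] [NormedAddCommGroup F]
    [NormedSpace ℝ F] (μ : Measure E) [μ.IsAddHaarMeasure] (g : E → F) (c : E) {R : ℝ}
    (hR : 0 < R) :
    ⨍ y in Metric.closedBall c R, g y ∂μ =
      ⨍ w in Metric.closedBall (0 : E) 1, g (c + R • w) ∂μ := by
  have htrans : ∫ y in Metric.closedBall c R, g y ∂μ =
      ∫ y in Metric.closedBall 0 R, g (c + y) ∂μ := by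
    rw [← (measurePreserving_add_left μ c).setIntegral_preimage_emb
      (MeasurableEquiv.addLeft c).measurableEmbedding]
    simp [preimage_add_closedBall]
  rw [setAverage_eq, setAverage_eq,
    Measure.setIntegral_comp_smul_of_pos μ (fun y => g (c + y)) _ hR,
    smul_closedBall _ _ zero_le_one, htrans, Measure.addHaar_real_closedBall' μ c hR.le, smul_smul]
  simp [abs_of_pos hR, mul_comm]

lemma setAverage_mono_of_le_add {X : Type*} [MeasurableSpace X] {μ : Measure X} {s : Set X}
    {f g h : X → ℝ} (hs : MeasurableSet s) (hf : IntegrableOn f s μ) (hg : IntegrableOn g s μ)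
    (hh : IntegrableOn h s μ) (hle : ∀ x ∈ s, f x ≤ g x + h x) :
    ⨍ x in s, f x ∂μ ≤ (⨍ x in s, g x ∂μ) + ⨍ x in s, h x ∂μ := by
  simp only [setAverage_eq, smul_eq_mul, ← mul_add]
  refine mul_le_mul_of_nonneg_left ?_ (by positivity)
  rw [← integral_add hg hh]
  exact setIntegral_mono_on hf (hg.add hh) hs hle

lemma volume_closedBall_inter_closedBall {d : ℕ} (c : Fin d → ℝ) {R r : ℝ} (hR : 0 ≤ R)
    (hr : 0 ≤ r) :
    volume (Metric.closedBall c R ∩ Metric.closedBall 0 r) =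
      ∏ i, ENNReal.ofReal (min (c i + R) r - max (c i - R) (-r)) := by
  rw [closedBall_pi _ hR, closedBall_pi _ hr, ← Set.pi_inter_distrib, volume_pi_pi]
  refine Finset.prod_congr rfl fun i _ => ?_
  rw [Real.closedBall_eq_Icc, Real.closedBall_eq_Icc, Icc_inter_Icc, Real.volume_Icc]
  simp

/-- A cube with sides `[-s, 1]` or `[-1, s]`, according to the signs `σ`. -/
def offsetCube {d : ℕ} (s : ℝ) (σ : Fin d → ℝ) : Set (Fin d → ℝ) :=
  Metric.closedBall (((1 - s) / 2) • σ) ((1 + s) / 2)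

lemma volume_offsetCube_inter_closedBall {d : ℕ} {s r : ℝ} (hs : 0 ≤ s) (hs1 : s ≤ 1)
    {σ : Fin d → ℝ} (hσ : ∀ i, σ i = 1 ∨ σ i = -1) (hr : 0 ≤ r) :
    volume (offsetCube s σ ∩ Metric.closedBall 0 r) =
      ENNReal.ofReal (min r 1 + min r s) ^ d := by
  rw [offsetCube, volume_closedBall_inter_closedBall _ (by linarith) hr]
  have (i : Fin d) : min ((((1 - s) / 2) • σ) i + (1 + s) / 2) r -
      max ((((1 - s) / 2) • σ) i - (1 + s) / 2) (-r) = min r 1 + min r s := by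
    rcases hσ i with h | h <;> simp only [Pi.smul_apply, smul_eq_mul, h] <;> grind
  simp only [this]
  simp

lemma volume_offsetCube {d : ℕ} {s : ℝ} (hs : 0 ≤ s) (σ : Fin d → ℝ) :
    volume (offsetCube s σ) = ENNReal.ofReal (1 + s) ^ d := by
  rw [offsetCube, Real.volume_pi_closedBall _ (by linarith), ENNReal.ofReal_pow (by linarith),
    mul_div_cancel₀ _ two_ne_zero]
  simp

lemma lintegral_Ioc_ofReal_deriv {G g : ℝ → ℝ} {a b : ℝ} (hab : a ≤ b)
    (hG : ContinuousOn G (Icc a b)) (hd : ∀ x ∈ Ioo a b, HasDerivAt G (g x) x)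
    (hg : ∀ x ∈ Ioo a b, 0 ≤ g x) :
    0 ≤ G b - G a ∧ ∫⁻ x in Ioc a b, ENNReal.ofReal (g x) = ENNReal.ofReal (G b - G a) := by
  have hint := intervalIntegral.integrableOn_deriv_of_nonneg hG hd hg
  rw [← intervalIntegral.integral_eq_sub_of_hasDerivAt_of_le hab hG hd
    ((intervalIntegrable_iff_integrableOn_Ioc_of_le hab).2 hint),
    intervalIntegral.integral_of_le hab, integral_Ioc_eq_integral_Ioo]
  refine ⟨setIntegral_nonneg measurableSet_Ioo hg, ?_⟩
  rw [ofReal_integral_eq_lintegral_ofReal (hint.mono_set Ioo_subset_Ioc_self)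
    ((ae_restrict_iff' measurableSet_Ioo).2 (Eventually.of_forall hg)),
    restrict_Ioo_eq_restrict_Ioc]

lemma abs_sSup_sub_sSup_le {A B : Set ℝ} {K : ℝ} (hA : A.Nonempty) (hB : B.Nonempty)
    (hK : 0 ≤ K) (hAB : ∀ a ∈ A, ∃ b ∈ B, a ≤ b + K) (hBA : ∀ b ∈ B, ∃ a ∈ A, b ≤ a + K) :
    |sSup A - sSup B| ≤ K := by
  have bdd {S T : Set ℝ} (h : ∀ a ∈ S, ∃ b ∈ T, a ≤ b + K) (hT : BddAbove T) : BddAbove S := by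
    obtain ⟨C, hC⟩ := hT
    refine ⟨C + K, fun a ha => ?_⟩
    obtain ⟨b, hb, hab⟩ := h a ha
    linarith [hC hb]
  have le {S T : Set ℝ} (hS : S.Nonempty) (h : ∀ a ∈ S, ∃ b ∈ T, a ≤ b + K)
      (hT : BddAbove T) : sSup S ≤ sSup T + K := by
    refine csSup_le hS fun a ha => ?_
    obtain ⟨b, hb, hab⟩ := h a ha
    linarith [le_csSup hT hb]
  by_cases h : BddAbove A
  · rw [abs_sub_le_iff]
    constructor <;> linarith [le hA hAB (bdd hBA h), le hB hBA h]
  · have h' : ¬ BddAbove B := fun h' => h (bdd hAB h')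
    simpa [Real.sSup_of_not_bddAbove h, Real.sSup_of_not_bddAbove h'] using hK

lemma maxFn_norm {d : ℕ} (f : (Fin d → ℝ) → ℝ) (x : Fin d → ℝ) :
    maxFn (fun x => ‖x‖) f x = sSup {a : ℝ | ∃ c : Fin d → ℝ, ∃ R : ℝ, 0 < R ∧
      x ∈ Metric.closedBall c R ∧ a = ⨍ y in Metric.closedBall c R, |f y|} := by
  have (c : Fin d → ℝ) (R : ℝ) : nball (fun x => ‖x‖) c R = Metric.closedBall c R := by
    ext y
    simp [nball, dist_eq_norm]
  simp only [maxFn, this]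

/-- The mean of `‖v‖ ^ α` over the cube `[-s, 1]^d`. -/
noncomputable def holderConst (d : ℕ) (α s : ℝ) : ℝ :=
  ((d : ℝ) / (1 + s) ^ d) *
    (2 ^ d * s ^ (α + (d : ℝ)) / (α + (d : ℝ)) +
      ∑ j ∈ Finset.range d, ((d - 1).choose j : ℝ) *
        (s ^ (d - 1 - j) - s ^ ((d : ℝ) + α)) / (α + (j : ℝ) + 1))

lemma lintegral_lowerPart (d : ℕ) {α s : ℝ} (hα : 0 < α) (hs : 0 ≤ s) (hs1 : s ≤ 1) :
    0 ≤ (1 + s) ^ d * s ^ α - α * (2 ^ d * s ^ (d + α) / (d + α)) ∧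
    ∫⁻ t in Ioc 0 s, ENNReal.ofReal (α * (((1 + s) ^ d - (2 * t) ^ d) * t ^ (α - 1))) =
      ENNReal.ofReal ((1 + s) ^ d * s ^ α - α * (2 ^ d * s ^ (d + α) / (d + α))) := by
  have hdα : (d : ℝ) + α ≠ 0 := by positivity
  have h := lintegral_Ioc_ofReal_deriv
    (G := fun t => (1 + s) ^ d * t ^ α - α * (2 ^ d * t ^ (d + α) / (d + α)))
    (g := fun t => α * (((1 + s) ^ d - (2 * t) ^ d) * t ^ (α - 1))) hs ?_ ?_ ?_
  · simpa [Real.zero_rpow hα.ne', Real.zero_rpow hdα] using h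
  · have h1 : 0 ≤ (d : ℝ) + α := by positivity
    fun_prop (disch := first | assumption | positivity)
  · intro t ht
    have h1 := Real.hasDerivAt_rpow_const (x := t) (p := α) (.inl ht.1.ne')
    have h2 := Real.hasDerivAt_rpow_const (x := t) (p := d + α) (.inl ht.1.ne')
    have h3 := (h1.const_mul ((1 + s) ^ d)).sub
      (((h2.const_mul (2 ^ d)).div_const (d + α)).const_mul α)
    refine h3.congr_deriv ?_
    rw [show (d : ℝ) + α - 1 = d + (α - 1) by ring, Real.rpow_add ht.1, Real.rpow_natCast, mul_pow]
    field_simp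
  · intro t ht
    have h : (2 * t) ^ d ≤ (1 + s) ^ d :=
      pow_le_pow_left₀ (by linarith [ht.1]) (by linarith [ht.2]) d
    exact mul_nonneg hα.le (mul_nonneg (by linarith) (Real.rpow_nonneg ht.1.le _))

lemma lintegral_upperPart {d : ℕ} (hd : 1 ≤ d) {α s : ℝ} (hα : 0 < α) (hs : 0 ≤ s)
    (hs1 : s ≤ 1) :
    0 ≤ d * ∑ j ∈ Finset.range d, ((d - 1).choose j : ℝ) *
        (s ^ (d - 1 - j) - s ^ ((d : ℝ) + α)) / (α + (j : ℝ) + 1) -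
          ((1 + s) ^ d * s ^ α - 2 ^ d * s ^ (d + α)) ∧
    ∫⁻ t in Ioc s 1, ENNReal.ofReal (α * (((1 + s) ^ d - (t + s) ^ d) * t ^ (α - 1))) =
      ENNReal.ofReal (d * ∑ j ∈ Finset.range d, ((d - 1).choose j : ℝ) *
        (s ^ (d - 1 - j) - s ^ ((d : ℝ) + α)) / (α + (j : ℝ) + 1) -
          ((1 + s) ^ d * s ^ α - 2 ^ d * s ^ (d + α))) := by
  have hj (j : ℕ) : 0 < α + j + 1 := by positivity
  have h := lintegral_Ioc_ofReal_deriv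
    (G := fun t => ((1 + s) ^ d - (t + s) ^ d) * t ^ α + d * ∑ j ∈ Finset.range d,
      ((d - 1).choose j : ℝ) * s ^ (d - 1 - j) * t ^ (α + j + 1) / (α + j + 1))
    (g := fun t => α * (((1 + s) ^ d - (t + s) ^ d) * t ^ (α - 1))) hs1 ?_ ?_ ?_
  · have h1 : s ^ ((d : ℝ) + α) = s ^ d * s ^ α := by
      rw [Real.rpow_add_of_nonneg hs (by positivity) hα.le, Real.rpow_natCast]
    have h2 : ∀ j ∈ Finset.range d, s ^ (d - 1 - j) * s ^ (α + j + 1) = s ^ ((d : ℝ) + α) := by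
      intro j hjd
      rw [Finset.mem_range] at hjd
      rw [← Real.rpow_natCast, ← Real.rpow_add_of_nonneg hs (by positivity) (hj j).le]
      congr 1
      push_cast [Nat.cast_sub (show j ≤ d - 1 by lia), Nat.cast_sub hd]
      ring
    have h3 : ∑ j ∈ Finset.range d, ((d - 1).choose j : ℝ) *
        (s ^ (d - 1 - j) - s ^ ((d : ℝ) + α)) / (α + (j : ℝ) + 1) =
        ∑ j ∈ Finset.range d, ((d - 1).choose j : ℝ) * s ^ (d - 1 - j) * 1 ^ (α + j + 1) /
          (α + j + 1) -
        ∑ j ∈ Finset.range d, ((d - 1).choose j : ℝ) * s ^ (d - 1 - j) * s ^ (α + j + 1) /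
          (α + j + 1) := by
      rw [← Finset.sum_sub_distrib]
      refine Finset.sum_congr rfl fun j hjd => ?_
      rw [mul_assoc _ _ (s ^ _), h2 j hjd, Real.one_rpow]
      ring
    have h4 (A B : ℝ) : d * (A - B) - ((1 + s) ^ d * s ^ α - 2 ^ d * (s ^ d * s ^ α)) =
        ((1 + s) ^ d - (1 + s) ^ d) * 1 ^ α + d * A -
          (((1 + s) ^ d - (s + s) ^ d) * s ^ α + d * B) := by
      rw [← two_mul s, mul_pow]
      ring
    rw [h3, h1, h4]
    exact h
  · have (j : ℕ) : 0 ≤ α + j + 1 := (hj j).le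
    fun_prop (disch := first | (intros; linarith [hj ‹ℕ›]) | positivity | grind)
  · intro t ht
    have ht0 : 0 < t := hs.trans_lt ht.1
    have h1 := ((((hasDerivAt_id t).add_const s).pow d).const_sub ((1 + s) ^ d)).mul
      (Real.hasDerivAt_rpow_const (x := t) (p := α) (.inl ht0.ne'))
    have h2 : HasDerivAt (fun t => ∑ j ∈ Finset.range d,
        ((d - 1).choose j : ℝ) * s ^ (d - 1 - j) * t ^ (α + j + 1) / (α + j + 1))
        (∑ j ∈ Finset.range d, ((d - 1).choose j : ℝ) * s ^ (d - 1 - j) *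
          ((α + j + 1) * t ^ (α + j + 1 - 1)) / (α + j + 1)) t :=
      HasDerivAt.fun_sum fun j _ => (((Real.hasDerivAt_rpow_const (x := t) (p := α + j + 1)
        (.inl ht0.ne')).const_mul _).div_const _)
    have h3 : ∑ j ∈ Finset.range d, ((d - 1).choose j : ℝ) * s ^ (d - 1 - j) *
          ((α + j + 1) * t ^ (α + j + 1 - 1)) / (α + j + 1) = (t + s) ^ (d - 1) * t ^ α := by
      rw [add_pow, Nat.sub_add_cancel hd, Finset.sum_mul]
      refine Finset.sum_congr rfl fun j _ => ?_
      rw [add_sub_cancel_right, Real.rpow_add ht0, Real.rpow_natCast]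
      field_simp [(hj j).ne']
    rw [h3] at h2
    refine (h1.add (h2.const_mul (d : ℝ))).congr_deriv ?_
    simp
    ring
  · intro t ht
    have ht0 : 0 < t := hs.trans_lt ht.1
    have h : (t + s) ^ d ≤ (1 + s) ^ d :=
      pow_le_pow_left₀ (by linarith) (by linarith [ht.2]) d
    exact mul_nonneg hα.le (mul_nonneg (by linarith) (Real.rpow_nonneg ht0.le _))

lemma volume_offsetCube_diff_closedBall {d : ℕ} {s r : ℝ} (hs : 0 ≤ s) (hs1 : s ≤ 1)
    {σ : Fin d → ℝ} (hσ : ∀ i, σ i = 1 ∨ σ i = -1) (hr : 0 ≤ r) :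
    volume (offsetCube s σ \ Metric.closedBall 0 r) =
      ENNReal.ofReal ((1 + s) ^ d - (min r 1 + min r s) ^ d) := by
  have h0 : 0 ≤ min r 1 + min r s := by positivity
  have h := measure_inter_add_sdiff (μ := volume) (offsetCube s σ)
    (Metric.isClosed_closedBall (x := (0 : Fin d → ℝ)) (ε := r)).measurableSet
  rw [volume_offsetCube_inter_closedBall hs hs1 hσ hr, volume_offsetCube hs] at h
  rw [ENNReal.ofReal_sub _ (by positivity), ENNReal.ofReal_pow (by positivity),
    ENNReal.ofReal_pow h0]
  exact ENNReal.eq_sub_of_add_eq (by finiteness) (by rwa [add_comm])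

lemma continuous_norm_rpow {E : Type*} [SeminormedAddCommGroup E] {α : ℝ} (hα : 0 < α) :
    Continuous fun v : E => ‖v‖ ^ α :=
  continuous_norm.rpow_const fun _ => .inr hα.le

lemma setAverage_offsetCube_norm_rpow {d : ℕ} (hd : 1 ≤ d) {α s : ℝ} (hα : 0 < α) (hs : 0 ≤ s)
    (hs1 : s ≤ 1) {σ : Fin d → ℝ} (hσ : ∀ i, σ i = 1 ∨ σ i = -1) :
    ⨍ v in offsetCube s σ, ‖v‖ ^ α = holderConst d α s := by
  have hmeas (t : ℝ) : volume.restrict (offsetCube s σ) {v | t < ‖v‖} =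
      volume (offsetCube s σ \ Metric.closedBall 0 t) := by
    rw [Measure.restrict_apply (measurableSet_lt measurable_const measurable_norm)]
    congr 1
    ext v
    simp [and_comm]
  have hint : ∫ v in offsetCube s σ, ‖v‖ ^ α = d * (2 ^ d * s ^ (α + (d : ℝ)) / (α + (d : ℝ)) +
      ∑ j ∈ Finset.range d, ((d - 1).choose j : ℝ) *
        (s ^ (d - 1 - j) - s ^ ((d : ℝ) + α)) / (α + (j : ℝ) + 1)) := by
    rw [integral_eq_lintegral_of_nonneg_ae (Eventually.of_forall fun v => by positivity)
      (continuous_norm_rpow hα).aestronglyMeasurable,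
      lintegral_rpow_eq_lintegral_meas_lt_mul _ (Eventually.of_forall fun v => by positivity)
      measurable_norm.aemeasurable hα, ← lintegral_const_mul' _ _ (by finiteness)]
    have hcongr : ∫⁻ t in Ioi 0, ENNReal.ofReal α *
        (volume.restrict (offsetCube s σ) {v | t < ‖v‖} * ENNReal.ofReal (t ^ (α - 1))) =
        ∫⁻ t in Ioi 0, ENNReal.ofReal
          (α * (((1 + s) ^ d - (min t 1 + min t s) ^ d) * t ^ (α - 1))) := by
      refine setLIntegral_congr_fun measurableSet_Ioi fun t ht => ?_
      have ht : 0 < t := ht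
      have h0 : 0 ≤ (1 + s) ^ d - (min t 1 + min t s) ^ d :=
        sub_nonneg.2 (pow_le_pow_left₀ (by positivity) (by gcongr <;> simp) d)
      rw [hmeas, volume_offsetCube_diff_closedBall hs hs1 hσ ht.le, ENNReal.ofReal_mul hα.le,
        ENNReal.ofReal_mul h0]
    rw [hcongr, ← Ioc_union_Ioi_eq_Ioi hs, lintegral_union measurableSet_Ioi
      (Ioc_disjoint_Ioi le_rfl), ← Ioc_union_Ioi_eq_Ioi hs1, lintegral_union measurableSet_Ioi
      (Ioc_disjoint_Ioi le_rfl)]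
    have e1 : ∫⁻ t in Ioc 0 s, ENNReal.ofReal
          (α * (((1 + s) ^ d - (min t 1 + min t s) ^ d) * t ^ (α - 1))) =
        ∫⁻ t in Ioc 0 s, ENNReal.ofReal (α * (((1 + s) ^ d - (2 * t) ^ d) * t ^ (α - 1))) := by
      refine setLIntegral_congr_fun measurableSet_Ioc fun t ht => ?_
      rw [min_eq_left (ht.2.trans hs1), min_eq_left ht.2, two_mul]
    have e2 : ∫⁻ t in Ioc s 1, ENNReal.ofReal
          (α * (((1 + s) ^ d - (min t 1 + min t s) ^ d) * t ^ (α - 1))) =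
        ∫⁻ t in Ioc s 1, ENNReal.ofReal (α * (((1 + s) ^ d - (t + s) ^ d) * t ^ (α - 1))) := by
      refine setLIntegral_congr_fun measurableSet_Ioc fun t ht => ?_
      rw [min_eq_left ht.2, min_eq_right ht.1.le]
    have e3 : ∫⁻ t in Ioi 1, ENNReal.ofReal
          (α * (((1 + s) ^ d - (min t 1 + min t s) ^ d) * t ^ (α - 1))) = 0 := by
      rw [setLIntegral_congr_fun (g := 0) measurableSet_Ioi fun t ht => ?_]
      · simp
      · have ht : 1 < t := ht
        rw [min_eq_right ht.le, min_eq_right (hs1.trans ht.le)]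
        simp
    obtain ⟨hlow, hlow'⟩ := lintegral_lowerPart d hα hs hs1
    obtain ⟨hup, hup'⟩ := lintegral_upperPart hd hα hs hs1
    rw [e1, e2, e3, hlow', hup', add_zero, ← ENNReal.ofReal_add hlow hup,
      ENNReal.toReal_ofReal (add_nonneg hlow hup)]
    have hdα : (d : ℝ) + α ≠ 0 := by positivity
    rw [add_comm α (d : ℝ)]
    field_simp
    ring
  rw [setAverage_eq, measureReal_def, volume_offsetCube hs, hint, holderConst]
  simp [ENNReal.toReal_ofReal (show 0 ≤ 1 + s by linarith)]
  ring

/-- Being Hölder of exponent `α` with constant `1`. -/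
def IsHolderOne {E : Type*} [SeminormedAddCommGroup E] (α : ℝ) (f : E → ℝ) : Prop :=
  ∀ x y, |f x - f y| ≤ ‖x - y‖ ^ α

lemma IsHolderOne.continuous {E : Type*} [SeminormedAddCommGroup E] {α : ℝ} {f : E → ℝ}
    (hα : 0 < α) (hf : IsHolderOne α f) : Continuous f := by
  refine continuous_iff_continuousAt.2 fun x => tendsto_iff_dist_tendsto_zero.2 ?_
  refine squeeze_zero (fun _ => dist_nonneg) (fun y => hf y x) ?_
  have h := (((continuous_norm_rpow (E := E) hα).comp (continuous_id.sub continuous_const)).tendsto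
    (x := x) : Tendsto (fun y => ‖y - x‖ ^ α) (𝓝 x) _)
  simpa [Function.comp_def, Real.zero_rpow hα.ne'] using h

lemma isHolderOne_of_holderNorm_eq_one {d : ℕ} {α : ℝ} (hα : 0 < α) {f : (Fin d → ℝ) → ℝ}
    (hf : holderNorm (fun x => ‖x‖) α f = 1) : IsHolderOne α f := by
  intro x y
  rcases eq_or_ne x y with rfl | hxy
  · simp [Real.zero_rpow hα.ne']
  have hbdd : BddAbove {a : ℝ | ∃ x y : Fin d → ℝ, x ≠ y ∧ a = |f x - f y| / ‖x - y‖ ^ α} := by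
    by_contra h
    rw [holderNorm, Real.sSup_of_not_bddAbove h] at hf
    exact zero_ne_one hf
  have h := (le_csSup hbdd ⟨x, y, hxy, rfl⟩).trans_eq hf
  have hpos : 0 < ‖x - y‖ ^ α := Real.rpow_pos_of_pos (norm_pos_iff.2 (sub_ne_zero.2 hxy)) _
  rwa [div_le_one hpos] at h

lemma exists_closedBall_average_le {d : ℕ} (hd : 1 ≤ d) {α s : ℝ} (hα : 0 < α) (hs : 0 ≤ s)
    (hs1 : s ≤ 1) {f : (Fin d → ℝ) → ℝ} (hf : IsHolderOne α f) {x : Fin d → ℝ}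
    (y : Fin d → ℝ) {c : Fin d → ℝ} {R : ℝ} (hR : 0 < R) (hx : x ∈ Metric.closedBall c R) :
    ∃ c' : Fin d → ℝ, ∃ R' : ℝ, 0 < R' ∧ y ∈ Metric.closedBall c' R' ∧
      ⨍ v in Metric.closedBall c R, |f v| ≤
        (⨍ v in Metric.closedBall c' R', |f v|) + ‖x - y‖ ^ α * holderConst d α s := by
  set δ := ‖x - y‖ with hδ
  have hδ0 : 0 ≤ δ := norm_nonneg _
  set σ : Fin d → ℝ := fun i => if x i ≤ y i then 1 else -1 with hσ_def
  have hσ (i) : σ i = 1 ∨ σ i = -1 := by simp only [hσ_def]; split_ifs <;> simp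
  set R' := R + δ * ((1 + s) / 2) with hR'
  have hR'0 : 0 < R' := by positivity
  refine ⟨c + (δ * ((1 - s) / 2)) • σ, R', hR'0, ?_, ?_⟩
  · rw [closedBall_pi _ hR.le] at hx
    rw [closedBall_pi _ hR'0.le]
    intro i _
    have h1 := hx i trivial
    have h2 : |x i - y i| ≤ δ := norm_le_pi_norm (x - y) i
    have h3 : 0 ≤ δ * s := mul_nonneg hδ0 hs
    simp only [Real.closedBall_eq_Icc, mem_Icc, Pi.add_apply, Pi.smul_apply, smul_eq_mul,
      hσ_def, hR'] at h1 ⊢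
    rw [abs_le] at h2
    split_ifs <;> constructor <;> linarith
  have hs' : 0 < (1 + s) / 2 := by linarith
  have hconst (g : (Fin d → ℝ) → ℝ) : δ ^ α * ⨍ w in Metric.closedBall 0 1, g w =
      ⨍ w in Metric.closedBall 0 1, δ ^ α * g w := by
    simp only [setAverage_eq, integral_const_mul, smul_eq_mul]
    ring
  rw [← setAverage_offsetCube_norm_rpow hd hα hs hs1 hσ, offsetCube,
    setAverage_closedBall_eq_unitBall _ _ _ hR, setAverage_closedBall_eq_unitBall _ _ _ hR'0,
    setAverage_closedBall_eq_unitBall _ _ _ hs', hconst]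
  have hfc := hf.continuous hα
  have hcomp : IsCompact (Metric.closedBall (0 : Fin d → ℝ) 1) := isCompact_closedBall _ _
  refine setAverage_mono_of_le_add measurableSet_closedBall ?_ ?_ ?_ fun w _ => ?_
  · exact (by fun_prop : Continuous fun w => |f (c + R • w)|).continuousOn.integrableOn_compact
      hcomp
  · exact (by fun_prop : Continuous fun w => |f (c + (δ * ((1 - s) / 2)) • σ + R' • w)|)
      |>.continuousOn.integrableOn_compact hcomp
  · have := continuous_norm_rpow (E := Fin d → ℝ) hα
    exact (continuous_const.mul (this.comp (by fun_prop : Continuous fun w : Fin d → ℝ =>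
      ((1 - s) / 2) • σ + ((1 + s) / 2) • w))).continuousOn.integrableOn_compact hcomp
  · have h1 := hf (c + R • w) (c + (δ * ((1 - s) / 2)) • σ + R' • w)
    have h2 : c + R • w - (c + (δ * ((1 - s) / 2)) • σ + R' • w) =
        (-δ) • (((1 - s) / 2) • σ + ((1 + s) / 2) • w) := by
      rw [hR']
      module
    rw [h2, norm_smul, Real.mul_rpow (norm_nonneg _) (norm_nonneg _), norm_neg,
      Real.norm_of_nonneg hδ0] at h1
    linarith [abs_sub_abs_le_abs_sub (f (c + R • w)) (f (c + (δ * ((1 - s) / 2)) • σ + R' • w))]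

lemma holderConst_nonneg {d : ℕ} (hd : 1 ≤ d) {α s : ℝ} (hα : 0 < α) (hs : 0 ≤ s)
    (hs1 : s ≤ 1) : 0 ≤ holderConst d α s := by
  rw [← setAverage_offsetCube_norm_rpow hd hα hs hs1 (σ := fun _ => 1) (by simp), setAverage_eq]
  exact smul_nonneg (by positivity) (integral_nonneg fun v => by positivity)

lemma abs_maxFn_sub_maxFn_le {d : ℕ} (hd : 1 ≤ d) {α s : ℝ} (hα : 0 < α) (hs : 0 ≤ s)
    (hs1 : s ≤ 1) {f : (Fin d → ℝ) → ℝ} (hf : IsHolderOne α f) (x y : Fin d → ℝ) :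
    |maxFn (fun x => ‖x‖) f x - maxFn (fun x => ‖x‖) f y| ≤
      ‖x - y‖ ^ α * holderConst d α s := by
  rw [maxFn_norm, maxFn_norm]
  have hne (z : Fin d → ℝ) : {a : ℝ | ∃ c : Fin d → ℝ, ∃ R : ℝ, 0 < R ∧
      z ∈ Metric.closedBall c R ∧ a = ⨍ y in Metric.closedBall c R, |f y|}.Nonempty :=
    ⟨_, z, 1, one_pos, Metric.mem_closedBall_self zero_le_one, rfl⟩
  refine abs_sSup_sub_sSup_le (hne x) (hne y)
    (mul_nonneg (by positivity) (holderConst_nonneg hd hα hs hs1)) ?_ ?_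
  · rintro _ ⟨c, R, hR, hx, rfl⟩
    obtain ⟨c', R', hR', hy, hle⟩ := exists_closedBall_average_le hd hα hs hs1 hf y hR hx
    exact ⟨_, ⟨c', R', hR', hy, rfl⟩, hle⟩
  · rintro _ ⟨c, R, hR, hy, rfl⟩
    obtain ⟨c', R', hR', hx, hle⟩ := exists_closedBall_average_le hd hα hs hs1 hf x hR hy
    exact ⟨_, ⟨c', R', hR', hx, rfl⟩, norm_sub_rev x y ▸ hle⟩

lemma holderConst_mem_upperBounds {d : ℕ} (hd : 1 ≤ d) {α s : ℝ} (hα : 0 < α) (hs : 0 ≤ s)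
    (hs1 : s ≤ 1) {f : (Fin d → ℝ) → ℝ} (hf : IsHolderOne α f) :
    holderConst d α s ∈ upperBounds {a : ℝ | ∃ x y : Fin d → ℝ, x ≠ y ∧
      a = |maxFn (fun x => ‖x‖) f x - maxFn (fun x => ‖x‖) f y| / ‖x - y‖ ^ α} := by
  rintro _ ⟨x, y, hxy, rfl⟩
  have hpos : 0 < ‖x - y‖ ^ α := Real.rpow_pos_of_pos (norm_pos_iff.2 (sub_ne_zero.2 hxy)) _
  rw [div_le_iff₀' hpos]
  exact abs_maxFn_sub_maxFn_le hd hα hs hs1 hf x y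

/-- The truncated power whose maximal function has the largest Hölder seminorm. -/
noncomputable def bump (d : ℕ) (α : ℝ) (v : Fin d → ℝ) : ℝ := max (1 - ‖v‖ ^ α) 0

lemma isHolderOne_bump (d : ℕ) {α : ℝ} (hα : 0 < α) (hα1 : α ≤ 1) :
    IsHolderOne α (bump d α) := by
  intro x y
  have h (a b : Fin d → ℝ) : ‖a‖ ^ α ≤ ‖a - b‖ ^ α + ‖b‖ ^ α :=
    (Real.rpow_le_rpow (norm_nonneg _) (norm_le_norm_sub_add a b) hα.le).trans
      (Real.rpow_add_le_add_rpow (norm_nonneg _) (norm_nonneg _) hα.le hα1)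
  have h1 := h x y
  have h2 := h y x
  rw [norm_sub_rev] at h2
  refine (abs_max_sub_max_le_abs _ _ _).trans ?_
  rw [abs_le]
  constructor <;> linarith

lemma holderNorm_bump {d : ℕ} (hd : 1 ≤ d) {α : ℝ} (hα : 0 < α) (hα1 : α ≤ 1) :
    holderNorm (fun x => ‖x‖) α (bump d α) = 1 := by
  have : Nonempty (Fin d) := ⟨⟨0, hd⟩⟩
  refine IsGreatest.csSup_eq ⟨⟨0, fun _ => 1, ?_, ?_⟩, ?_⟩
  · intro h
    exact zero_ne_one (congrFun h ⟨0, hd⟩)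
  · simp [bump, pi_norm_const, Real.zero_rpow hα.ne']
  · rintro _ ⟨x, y, hxy, rfl⟩
    exact div_le_one_of_le₀ (isHolderOne_bump d hα hα1 x y) (by positivity)

lemma setAverage_le_setAverage_of_superlevel {X : Type*} [MeasurableSpace X] {μ : Measure X}
    {S T : Set X} {f : X → ℝ} (hf0 : ∀ x, 0 ≤ f x) (hf : Measurable f) (hS0 : μ S ≠ 0)
    (hS : μ S ≠ ⊤) (hT0 : μ T ≠ 0) (hT : μ T ≠ ⊤) (hfT : IntegrableOn f T μ)
    (h : ∀ t, 0 < t → μ (S ∩ {x | t ≤ f x}) * μ T ≤ μ (T ∩ {x | t ≤ f x}) * μ S) :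
    ⨍ x in S, f x ∂μ ≤ ⨍ x in T, f x ∂μ := by
  have hlayer (U : Set X) : ∫⁻ x in U, ENNReal.ofReal (f x) ∂μ =
      ∫⁻ t in Ioi 0, μ (U ∩ {x | t ≤ f x}) := by
    rw [lintegral_eq_lintegral_meas_le _ (Eventually.of_forall hf0) hf.aemeasurable]
    refine lintegral_congr fun t => ?_
    rw [Measure.restrict_apply (measurableSet_le measurable_const hf), inter_comm]
  have hle : (∫⁻ x in S, ENNReal.ofReal (f x) ∂μ) * μ T ≤
      (∫⁻ x in T, ENNReal.ofReal (f x) ∂μ) * μ S := by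
    rw [hlayer, hlayer, ← lintegral_mul_const' _ _ hT, ← lintegral_mul_const' _ _ hS]
    exact setLIntegral_mono' measurableSet_Ioi h
  have hreal := ENNReal.toReal_mono (ENNReal.mul_ne_top hfT.lintegral_lt_top.ne hS) hle
  rw [ENNReal.toReal_mul, ENNReal.toReal_mul,
    ← integral_eq_lintegral_of_nonneg_ae (Eventually.of_forall hf0) hf.aestronglyMeasurable,
    ← integral_eq_lintegral_of_nonneg_ae (Eventually.of_forall hf0) hf.aestronglyMeasurable]
    at hreal
  simp only [setAverage_eq, smul_eq_mul, inv_mul_eq_div, measureReal_def]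
  rwa [div_le_div_iff₀ (ENNReal.toReal_pos hS0 hS) (ENNReal.toReal_pos hT0 hT)]

lemma exists_volume_closedBall_inter_mul_le {d : ℕ} {c : Fin d → ℝ} {R : ℝ} (hR : 0 < R)
    (hc : (fun _ => 1 : Fin d → ℝ) ∈ Metric.closedBall c R) :
    ∃ s : ℝ, 0 ≤ s ∧ s ≤ 1 ∧ ∀ r, 0 ≤ r → r ≤ 1 →
      volume (Metric.closedBall c R ∩ Metric.closedBall 0 r) *
          volume (offsetCube s (fun _ => 1 : Fin d → ℝ)) ≤
        volume (offsetCube s (fun _ => 1 : Fin d → ℝ) ∩ Metric.closedBall 0 r) *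
          volume (Metric.closedBall c R) := by
  set s : ℝ := max 0 (min (2 * R - 1) 1) with hs
  have hs0 : 0 ≤ s := le_max_left _ _
  have hs1 : s ≤ 1 := max_le zero_le_one (min_le_right _ _)
  refine ⟨s, hs0, hs1, fun r hr hr1 => ?_⟩
  rw [volume_closedBall_inter_closedBall c hR.le hr, volume_offsetCube hs0,
    volume_offsetCube_inter_closedBall hs0 hs1 (by simp) hr,
    Real.volume_pi_closedBall _ hR.le, ENNReal.ofReal_pow (by positivity), Fintype.card_fin,
    ← mul_pow, ← Fin.prod_const d (ENNReal.ofReal (1 + s)), ← Fin.prod_const d (_ * _),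
    ← Finset.prod_mul_distrib]
  refine Finset.prod_le_prod' fun i _ => ?_
  have h0 : 0 ≤ min r 1 + min r s := by positivity
  rw [← ENNReal.ofReal_mul' (by linarith), ← ENNReal.ofReal_mul' (by positivity)]
  refine ENNReal.ofReal_le_ofReal ?_
  rw [closedBall_pi _ hR.le] at hc
  have h1 : (1 : ℝ) ∈ Metric.closedBall (c i) R := hc i trivial
  rw [Real.closedBall_eq_Icc] at h1
  obtain ⟨h1, h2⟩ := h1
  have h3 : min (c i + R) r - max (c i - R) (-r) ≤ r + min (2 * R - 1) r := by grind
  refine (mul_le_mul_of_nonneg_right h3 (by linarith)).trans ?_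
  rw [min_eq_left hr1]
  rcases le_total (2 * R) 1 with h | h
  · have : s = 0 := by grind
    rw [this, min_eq_right hr]
    nlinarith [min_le_left (2 * R - 1) r]
  rcases le_total (2 * R) 2 with h' | h'
  · have : s = 2 * R - 1 := by grind
    rw [this, min_comm]
    linarith
  · have : s = 1 := by grind
    rw [this, min_eq_left hr1]
    nlinarith [min_le_right (2 * R - 1) r]

lemma setOf_le_bump (d : ℕ) {α t : ℝ} (hα : 0 < α) (ht : 0 < t) (ht1 : t ≤ 1) :
    {v | t ≤ bump d α v} = Metric.closedBall 0 ((1 - t) ^ α⁻¹) := by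
  ext v
  rw [mem_closedBall_zero_iff, Real.le_rpow_inv_iff_of_pos (norm_nonneg _) (by linarith) hα,
    mem_ofPred_eq, bump, le_max_iff, or_iff_left ht.not_ge]
  constructor <;> intro <;> linarith

lemma bump_nonneg (d : ℕ) (α : ℝ) (v : Fin d → ℝ) : 0 ≤ bump d α v := le_max_right _ _

lemma bump_le_one (d : ℕ) (α : ℝ) (v : Fin d → ℝ) : bump d α v ≤ 1 :=
  max_le (sub_le_self _ (by positivity)) zero_le_one

lemma continuous_bump (d : ℕ) {α : ℝ} (hα : 0 < α) : Continuous (bump d α) :=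
  (continuous_const.sub (continuous_norm_rpow hα)).max continuous_const

lemma volume_closedBall_ne_zero {d : ℕ} (c : Fin d → ℝ) {R : ℝ} (hR : 0 < R) :
    volume (Metric.closedBall c R) ≠ 0 :=
  (Metric.measure_closedBall_pos volume c hR).ne'

lemma setAverage_closedBall_mem_Icc {d : ℕ} {f : (Fin d → ℝ) → ℝ} (hf : Continuous f)
    (c : Fin d → ℝ) {R a b : ℝ} (hR : 0 < R)
    (h : ∀ v ∈ Metric.closedBall c R, f v ∈ Icc a b) :
    ⨍ v in Metric.closedBall c R, f v ∈ Icc a b :=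
  (convex_Icc a b).set_average_mem isClosed_Icc (volume_closedBall_ne_zero c hR)
    measure_closedBall_lt_top.ne
    ((ae_restrict_iff' measurableSet_closedBall).2 (Eventually.of_forall h))
    (hf.continuousOn.integrableOn_compact (isCompact_closedBall _ _))

lemma setAverage_offsetCube_bump_le {d : ℕ} (hd : 1 ≤ d) {α s : ℝ} (hα : 0 < α) (hs : 0 ≤ s)
    (hs1 : s ≤ 1) :
    ⨍ v in offsetCube s (fun _ => 1 : Fin d → ℝ), bump d α v ≤ 1 - holderConst d α s := by
  have hR : 0 < (1 + s) / 2 := by linarith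
  rw [← setAverage_offsetCube_norm_rpow hd hα hs hs1 (σ := fun _ => 1) (by simp), le_sub_iff_add_le]
  have hcomp : IsCompact (offsetCube s (fun _ => 1 : Fin d → ℝ)) := isCompact_closedBall _ _
  have hvol : volume.real (offsetCube s (fun _ => 1 : Fin d → ℝ)) ≠ 0 :=
    (ENNReal.toReal_pos (volume_closedBall_ne_zero _ hR) measure_closedBall_lt_top.ne).ne'
  rw [setAverage_eq, setAverage_eq, ← smul_add, ← integral_add
    ((continuous_bump d hα).continuousOn.integrableOn_compact hcomp)
    ((continuous_norm_rpow hα).continuousOn.integrableOn_compact hcomp),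
    setIntegral_congr_fun (g := fun _ => 1) hcomp.measurableSet]
  · simp [hvol]
  · intro v hv
    have : Nonempty (Fin d) := ⟨⟨0, hd⟩⟩
    have h1 : ‖v‖ ≤ 1 := by
      have h2 : ‖v - ((1 - s) / 2) • (fun _ => 1 : Fin d → ℝ)‖ ≤ (1 + s) / 2 :=
        mem_closedBall_iff_norm.1 hv
      have h3 := norm_le_norm_sub_add v (((1 - s) / 2) • (fun _ => 1 : Fin d → ℝ))
      rw [norm_smul ((1 - s) / 2), pi_norm_const, norm_one, Real.norm_of_nonneg (by linarith)]
        at h3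
      linarith
    have h4 : ‖v‖ ^ α ≤ 1 := Real.rpow_le_one (norm_nonneg _) h1 hα.le
    simp only [bump]
    rw [max_eq_left (by linarith)]
    ring

lemma maxFn_bump_one_le {d : ℕ} (hd : 1 ≤ d) {α b : ℝ} (hα : 0 < α)
    (hb : ∀ s, 0 ≤ s → s ≤ 1 → b ≤ holderConst d α s) :
    maxFn (fun x => ‖x‖) (bump d α) (fun _ => 1) ≤ 1 - b := by
  rw [maxFn_norm]
  refine csSup_le ⟨_, fun _ => 1, 1, one_pos, Metric.mem_closedBall_self zero_le_one, rfl⟩ ?_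
  rintro _ ⟨c, R, hR, hc, rfl⟩
  obtain ⟨s, hs, hs1, h⟩ := exists_volume_closedBall_inter_mul_le hR hc
  simp only [abs_of_nonneg (bump_nonneg d α _)]
  have hR' : 0 < (1 + s) / 2 := by linarith
  refine (setAverage_le_setAverage_of_superlevel (bump_nonneg d α)
    (continuous_bump d hα).measurable (volume_closedBall_ne_zero c hR)
    measure_closedBall_lt_top.ne (volume_closedBall_ne_zero _ hR') measure_closedBall_lt_top.ne
    ((continuous_bump d hα).continuousOn.integrableOn_compact (isCompact_closedBall _ _))
    fun t ht => ?_).trans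
    ((setAverage_offsetCube_bump_le hd hα hs hs1).trans (sub_le_sub_left (hb s hs hs1) 1))
  rcases le_or_gt t 1 with ht1 | ht1
  · rw [setOf_le_bump d hα ht ht1]
    exact h _ (by positivity) (Real.rpow_le_one (by linarith) (by linarith) (by positivity))
  · rw [show {v | t ≤ bump d α v} = ∅ from
      eq_empty_of_forall_notMem fun v hv => (ht1.trans_le hv).not_ge (bump_le_one d α v)]
    simp

lemma one_le_maxFn_bump_zero (d : ℕ) {α : ℝ} (hα : 0 < α) :
    1 ≤ maxFn (fun x => ‖x‖) (bump d α) 0 := by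
  rw [maxFn_norm]
  simp only [abs_of_nonneg (bump_nonneg d α _)]
  have hbdd : BddAbove {a : ℝ | ∃ c : Fin d → ℝ, ∃ R : ℝ, 0 < R ∧
      0 ∈ Metric.closedBall c R ∧ a = ⨍ y in Metric.closedBall c R, bump d α y} := by
    refine ⟨1, ?_⟩
    rintro _ ⟨c, R, hR, -, rfl⟩
    exact (setAverage_closedBall_mem_Icc (continuous_bump d hα) c hR
      fun v _ => ⟨bump_nonneg d α v, bump_le_one d α v⟩).2
  have hlim : Tendsto (fun ε : ℝ => 1 - ε ^ α) (𝓝[>] 0) (𝓝 1) := by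
    have : Continuous fun ε : ℝ => 1 - ε ^ α :=
      continuous_const.sub (Real.continuous_rpow_const hα.le)
    have h := this.tendsto 0
    rw [Real.zero_rpow hα.ne', sub_zero] at h
    exact h.mono_left nhdsWithin_le_nhds
  refine le_of_tendsto hlim (eventually_mem_nhdsWithin.mono fun ε hε => ?_)
  have hε : 0 < ε := hε
  refine le_trans ?_
    (le_csSup hbdd ⟨0, ε, hε, Metric.mem_closedBall_self hε.le, rfl⟩)
  refine (setAverage_closedBall_mem_Icc (b := 1) (continuous_bump d hα) 0 hε
      fun v hv => ⟨?_, bump_le_one d α v⟩).1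
  exact le_max_of_le_left (sub_le_sub_left
    (Real.rpow_le_rpow (norm_nonneg _) (mem_closedBall_zero_iff.1 hv) hα.le) 1)

lemma continuousOn_holderConst (d : ℕ) {α : ℝ} (hα : 0 < α) :
    ContinuousOn (holderConst d α) (Icc 0 1) := by
  have h1 : ∀ s ∈ Icc (0 : ℝ) 1, (1 + s) ^ d ≠ 0 := fun s hs =>
    (pow_pos (by linarith [hs.1]) d).ne'
  have h2 : 0 ≤ α + (d : ℝ) := by positivity
  have h3 : 0 ≤ (d : ℝ) + α := by positivity
  unfold holderConst
  refine (continuousOn_const.div (by fun_prop) h1).mul (Continuous.continuousOn ?_)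
  have := Real.continuous_rpow_const h2
  have := Real.continuous_rpow_const h3
  fun_prop

/-- The operator norm of the uncentered maximal operator associated to `ℓ∞` balls on the
Hölder class `Lip_α(ℝ^d, ‖·‖_∞)` is the minimum over `s ∈ [0,1]` of the explicit expression
`(d/(1+s)^d)[2^d s^{α+d}/(α+d) + Σ_{j=0}^{d−1} C(d−1,j)(s^{d−1−j} − s^{d+α})/(α+j+1)]`. -/
theorem stmt7 (d : ℕ) (hd : 1 ≤ d) (α : ℝ) (hα : 0 < α) (hα1 : α ≤ 1) :
    IsLeast {b : ℝ | ∃ s : ℝ, 0 ≤ s ∧ s ≤ 1 ∧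
        b = ((d : ℝ) / (1 + s) ^ d) *
              (2 ^ d * s ^ (α + (d : ℝ)) / (α + (d : ℝ)) +
                ∑ j ∈ Finset.range d, ((d - 1).choose j : ℝ) *
                  (s ^ (d - 1 - j) - s ^ ((d : ℝ) + α)) / (α + (j : ℝ) + 1))}
      (opNormHolder d (fun x => ‖x‖) α) := by

  change IsLeast {b : ℝ | ∃ s : ℝ, 0 ≤ s ∧ s ≤ 1 ∧ b = holderConst d α s} _
  have : Nonempty (Fin d) := ⟨⟨0, hd⟩⟩
  have upper {f : (Fin d → ℝ) → ℝ} (hf : holderNorm (fun x => ‖x‖) α f = 1) {s : ℝ}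
      (hs : 0 ≤ s) (hs1 : s ≤ 1) :=
    holderConst_mem_upperBounds hd hα hs hs1 (isHolderOne_of_holderNorm_eq_one hα hf)
  have hnorm_le {f : (Fin d → ℝ) → ℝ} (hf : holderNorm (fun x => ‖x‖) α f = 1) {s : ℝ}
      (hs : 0 ≤ s) (hs1 : s ≤ 1) :
      holderNorm (fun x => ‖x‖) α (maxFn (fun x => ‖x‖) f) ≤ holderConst d α s :=
    csSup_le ⟨_, 0, fun _ => 1, fun h => zero_ne_one (congrFun h ⟨0, hd⟩), rfl⟩ (upper hf hs hs1)
  have hbump := holderNorm_bump hd hα hα1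
  have hle {s : ℝ} (hs : 0 ≤ s) (hs1 : s ≤ 1) :
      opNormHolder d (fun x => ‖x‖) α ≤ holderConst d α s := by
    refine csSup_le ⟨_, bump d α, hbump, rfl⟩ ?_
    rintro _ ⟨f, hf, rfl⟩
    exact hnorm_le hf hs hs1
  obtain ⟨s, ⟨hs, hs1⟩, hmin⟩ := isCompact_Icc.exists_isMinOn
    (nonempty_Icc.2 (zero_le_one (α := ℝ))) (continuousOn_holderConst d hα)
  refine ⟨⟨s, hs, hs1, le_antisymm (hle hs hs1) ?_⟩, ?_⟩
  · have h1 := one_le_maxFn_bump_zero d hα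
    have h2 := maxFn_bump_one_le hd hα fun t ht ht1 => hmin (show t ∈ Icc 0 1 from ⟨ht, ht1⟩)
    have h3 : |maxFn (fun x => ‖x‖) (bump d α) 0 -
        maxFn (fun x => ‖x‖) (bump d α) (fun _ => 1)| /
        ‖(0 : Fin d → ℝ) - fun _ => 1‖ ^ α ≤
          holderNorm (fun x => ‖x‖) α (maxFn (fun x => ‖x‖) (bump d α)) :=
      le_csSup ⟨_, upper hbump hs hs1⟩
        ⟨0, fun _ => 1, fun h => zero_ne_one (congrFun h ⟨0, hd⟩), rfl⟩
    rw [zero_sub, norm_neg, pi_norm_const, norm_one, Real.one_rpow, div_one] at h3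
    have h4 : holderNorm (fun x => ‖x‖) α (maxFn (fun x => ‖x‖) (bump d α)) ≤
        opNormHolder d (fun x => ‖x‖) α := by
      refine le_csSup ⟨holderConst d α s, ?_⟩ ⟨bump d α, hbump, rfl⟩
      rintro _ ⟨f, hf, rfl⟩
      exact hnorm_le hf hs hs1
    linarith [le_abs_self (maxFn (fun x => ‖x‖) (bump d α) 0 -
      maxFn (fun x => ‖x‖) (bump d α) (fun _ => 1))]
  · rintro _ ⟨t, ht, ht1, rfl⟩
    exact hle ht ht1
end
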